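/- arXiv:2209.14360 — 2 statements merged into one kernel-verified Lean document; each statement's English description precedes it below -/
import Mathlib

section
/- Let n ∈ ℕ, let k₁, k₂, Γ, D be real numbers with k₁ > 0, k₂ > 0, 0 < Γ < k₁k₂ and D ≥ 0. Let x̃ : ℝ → EuclideanSpace ℝ (Fin n) be twice differentiable and let w : ℝ → EuclideanSpace ℝ (Fin n) satisfy ‖w(t)‖ ≤ D for all t, such that x̃''(t) = -k₁k₂·x̃(t) - (k₁+k₂)·x̃'(t) + w(t) for all t. Define r(t) = x̃'(t) + k₁·x̃(t) and V(t) = ‖r(t)‖² + Γ·‖x̃(t)‖². Then V is differentiable and for every t, V'(t) ≤ -(k₂ - Γ/k₁)·‖r(t)‖² - Γ·k₁·‖x̃(t)‖² + D²/k₂. -/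
/-- Weighted Young inequality for the inner product. -/
theorem two_mul_inner_le_mul_sq_add_sq_div {E : Type*} [NormedAddCommGroup E]
    [InnerProductSpace ℝ E] {c : ℝ} (hc : 0 < c) (x y : E) :
    2 * inner ℝ x y ≤ c * ‖x‖ ^ 2 + ‖y‖ ^ 2 / c := by
  have hxy : inner ℝ x y ≤ ‖x‖ * ‖y‖ := real_inner_le_norm x y
  have hsq : c * ‖x‖ ^ 2 + ‖y‖ ^ 2 / c - 2 * (‖x‖ * ‖y‖) = (c * ‖x‖ - ‖y‖) ^ 2 / c := by
    field_simp
    ring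
  have hnonneg : 0 ≤ (c * ‖x‖ - ‖y‖) ^ 2 / c := by positivity
  linarith

/-- Lyapunov-derivative bound for the closed-loop error dynamics
`xt'' = -k₁k₂ xt - (k₁+k₂) xt' + w` with `‖w‖ ≤ D`, filtered error
`r = xt' + k₁ xt` and Lyapunov function `V = ‖r‖² + Γ ‖xt‖²`. -/
theorem lyapunov_derivative_bound (n : ℕ) (k₁ k₂ Γ D : ℝ)
    (hk₁ : 0 < k₁) (hk₂ : 0 < k₂) (hΓ : 0 < Γ) (hΓk : Γ < k₁ * k₂) (hD : 0 ≤ D)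
    (xt : ℝ → EuclideanSpace ℝ (Fin n))
    (hx₁ : Differentiable ℝ xt) (hx₂ : Differentiable ℝ (deriv xt))
    (w : ℝ → EuclideanSpace ℝ (Fin n)) (hw : ∀ t, ‖w t‖ ≤ D)
    (hode : ∀ t, deriv (deriv xt) t =
      -((k₁ * k₂) • xt t) - (k₁ + k₂) • deriv xt t + w t)
    (r : ℝ → EuclideanSpace ℝ (Fin n))
    (hr : ∀ t, r t = deriv xt t + k₁ • xt t)
    (V : ℝ → ℝ) (hV : ∀ t, V t = ‖r t‖ ^ 2 + Γ * ‖xt t‖ ^ 2) :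
    Differentiable ℝ V ∧
      ∀ t, deriv V t ≤
        -(k₂ - Γ / k₁) * ‖r t‖ ^ 2 - Γ * k₁ * ‖xt t‖ ^ 2 + D ^ 2 / k₂ := by
  have hr_eq : r = fun t => deriv xt t + k₁ • xt t := funext hr
  have hV_eq : V = fun t => ‖r t‖ ^ 2 + Γ * ‖xt t‖ ^ 2 := funext hV
  have hx' (t : ℝ) : HasDerivAt xt (r t - k₁ • xt t) t := by
    rw [hr, add_sub_cancel_right]
    exact (hx₁ t).hasDerivAt
  have hr' (t : ℝ) : HasDerivAt r (w t - k₂ • r t) t := by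
    have h := (hx₂ t).hasDerivAt.add ((hx₁ t).hasDerivAt.const_smul k₁)
    have hderiv : deriv (deriv xt) t + k₁ • deriv xt t = w t - k₂ • r t := by
      rw [hode, hr]
      module
    rw [hderiv] at h
    rw [hr_eq] at h ⊢
    exact h
  have hV' (t : ℝ) : HasDerivAt V
      (2 * inner ℝ (r t) (w t - k₂ • r t) +
        Γ * (2 * inner ℝ (xt t) (r t - k₁ • xt t))) t := by
    rw [hV_eq]
    exact (hr' t).norm_sq.add ((hx' t).norm_sq.const_mul Γ)
  refine ⟨fun t => (hV' t).differentiableAt, fun t => ?_⟩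
  rw [(hV' t).deriv]
  simp only [inner_sub_right, real_inner_smul_right, real_inner_self_eq_norm_sq]
  have hrw := two_mul_inner_le_mul_sq_add_sq_div hk₂ (r t) (w t)
  have hwD : ‖w t‖ ^ 2 / k₂ ≤ D ^ 2 / k₂ := by
    gcongr
    exact hw t
  have hxr := mul_le_mul_of_nonneg_left
    (two_mul_inner_le_mul_sq_add_sq_div hk₁ (xt t) (r t)) hΓ.le
  have hdiv : Γ / k₁ * ‖r t‖ ^ 2 = Γ * (‖r t‖ ^ 2 / k₁) := by ring
  linarith
end

section
/- Let n ∈ ℕ, let k₁, k₂, Γ, D be real numbers with k₁ > 0, k₂ > 0, 0 < Γ < k₁k₂ and D ≥ 0. Let x̃ : ℝ → EuclideanSpace ℝ (Fin n) be twice differentiable and let w : ℝ → EuclideanSpace ℝ (Fin n) satisfy ‖w(t)‖ ≤ D for all t, such that x̃''(t) = -k₁k₂·x̃(t) - (k₁+k₂)·x̃'(t) + w(t) for all t. Define r(t) = x̃'(t) + k₁·x̃(t), V(t) = ‖r(t)‖² + Γ·‖x̃(t)‖², and c = D²/(k₂·(k₂ - Γ/k₁)) + D²/(k₁·k₂). If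 V(0) ≤ c, then for all t ≥ 0 one has V(t) ≤ c, and consequently ‖x̃(t)‖ ≤ √(c/Γ) and ‖r(t)‖ ≤ √c. -/
/-- Outside the sublevel set, the bound on the Lyapunov derivative is nonpositive. -/
lemma lyapunov_rate_nonpos {k₁ k₂ Γ D a b : ℝ} (hk₁ : 0 < k₁) (hk₂ : 0 < k₂) (hΓ : 0 < Γ)
    (hΓk : Γ < k₁ * k₂) (ha : 0 ≤ a)
    (h : D ^ 2 / (k₂ * (k₂ - Γ / k₁)) + D ^ 2 / (k₁ * k₂) ≤ a ^ 2 + Γ * b ^ 2) :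
    -(k₂ * a ^ 2) + a * D + Γ * (a * b) - Γ * k₁ * b ^ 2 ≤ 0 := by
  by_contra! hpos
  obtain ⟨s, hs⟩ : ∃ s, s = Γ / k₁ := ⟨_, rfl⟩
  have hΓs : Γ = s * k₁ := by rw [hs]; field_simp
  have hs0 : 0 < s := hs ▸ div_pos hΓ hk₁
  have hsk : s < k₂ := by rw [hs, div_lt_iff₀ hk₁]; linarith
  rw [← hs] at h
  have ha_bound : a ^ 2 < D ^ 2 / (k₂ * (k₂ - s)) := by
    have ha0 : 0 < a := by
      rcases ha.eq_or_lt with rfl | ha0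
      · have : 0 ≤ Γ * k₁ * b ^ 2 := by positivity
        nlinarith
      · exact ha0
    have hsq : 0 ≤ s * (k₁ * b - a / 2) ^ 2 := by positivity
    have hlin : a * (k₂ - s / 4) < D := by
      refine lt_of_mul_lt_mul_left ?_ ha
      rw [hΓs] at hpos
      nlinarith
    have hcoef : 0 < k₂ - s / 4 := by linarith
    have hsq_lt : (a * (k₂ - s / 4)) ^ 2 < D ^ 2 := pow_lt_pow_left₀ hlin (by positivity) two_ne_zero
    rw [lt_div_iff₀ (mul_pos hk₂ (sub_pos.2 hsk))]
    have : 0 ≤ a ^ 2 * ((k₂ - s / 4) ^ 2 - k₂ * (k₂ - s)) := by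
      have : (k₂ - s / 4) ^ 2 - k₂ * (k₂ - s) = k₂ * s / 2 + s ^ 2 / 16 := by ring
      rw [this]
      positivity
    nlinarith
  have hb_bound : Γ * b ^ 2 < D ^ 2 / (k₁ * k₂) := by
    rw [lt_div_iff₀ (mul_pos hk₁ hk₂)]
    by_contra! hD
    have hΓb : Γ * Γ * b ^ 2 ≤ Γ * (k₁ * k₂) * b ^ 2 := by gcongr
    have hscaled := mul_pos hk₂ hpos
    nlinarith [sq_nonneg (D + Γ * b - 2 * k₂ * a), sq_nonneg (D - Γ * b)]
  linarith

/-- A sublevel set of a function of time is forward invariant if the function has nonpositive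
derivative whenever its value is at least the level. -/
lemma le_of_deriv_nonpos_above_level {V V' : ℝ → ℝ} {c : ℝ}
    (hV : ∀ t, HasDerivAt V (V' t) t) (hV' : ∀ t, c ≤ V t → V' t ≤ 0) (h0 : V 0 ≤ c)
    {t : ℝ} (ht : 0 ≤ t) : V t ≤ c := by
  have hlin : ∀ ε > 0, V t ≤ c + ε * t := by
    intro ε hε
    refine image_le_of_deriv_right_lt_deriv_boundary (f := V) (f' := V') (a := 0) (b := t)
      (B := fun x => c + ε * x) (B' := fun _ => ε)
      (fun x _ => (hV x).continuousAt.continuousWithinAt) (fun x _ => (hV x).hasDerivWithinAt)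
      (by simpa using h0) (fun x => ?_) (fun x hx hVx => ?_) ⟨ht, le_rfl⟩
    · simpa using ((hasDerivAt_id x).const_mul ε).const_add c
    · refine (hV' x ?_).trans_lt hε
      rw [hVx]
      have := mul_nonneg hε.le hx.1
      linarith
  refine le_of_forall_pos_le_add fun δ hδ => ?_
  refine (hlin (δ / (t + 1)) (by positivity)).trans ?_
  have : δ / (t + 1) * t ≤ δ := by
    rw [div_mul_eq_mul_div, div_le_iff₀ (by positivity)]
    nlinarith
  linarith

/-- Forward-invariance / ultimate-boundedness form of Theorem 1. -/
theorem forward_invariance_boundedness (n : ℕ) (k₁ k₂ Γ D : ℝ)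
    (hk₁ : 0 < k₁) (hk₂ : 0 < k₂) (hΓ : 0 < Γ) (hΓk : Γ < k₁ * k₂) (hD : 0 ≤ D)
    (xt : ℝ → EuclideanSpace ℝ (Fin n))
    (hx₁ : Differentiable ℝ xt) (hx₂ : Differentiable ℝ (deriv xt))
    (w : ℝ → EuclideanSpace ℝ (Fin n)) (hw : ∀ t, ‖w t‖ ≤ D)
    (hode : ∀ t, deriv (deriv xt) t =
      -((k₁ * k₂) • xt t) - (k₁ + k₂) • deriv xt t + w t)
    (r : ℝ → EuclideanSpace ℝ (Fin n))
    (hr : ∀ t, r t = deriv xt t + k₁ • xt t)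
    (V : ℝ → ℝ) (hV : ∀ t, V t = ‖r t‖ ^ 2 + Γ * ‖xt t‖ ^ 2)
    (c : ℝ) (hc : c = D ^ 2 / (k₂ * (k₂ - Γ / k₁)) + D ^ 2 / (k₁ * k₂))
    (h0 : V 0 ≤ c) :
    ∀ t ≥ (0 : ℝ), V t ≤ c ∧ ‖xt t‖ ≤ Real.sqrt (c / Γ) ∧ ‖r t‖ ≤ Real.sqrt c := by
  have hrd : ∀ t, HasDerivAt r (-(k₂ • r t) + w t) t := by
    intro t
    have h := (hx₂ t).hasDerivAt.add ((hx₁ t).hasDerivAt.const_smul k₁)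
    rw [funext hr]
    refine h.congr_deriv ?_
    rw [hode]
    module
  have hxd : ∀ t, HasDerivAt xt (r t - k₁ • xt t) t := by
    intro t
    refine (hx₁ t).hasDerivAt.congr_deriv ?_
    rw [hr]
    module
  have hVd : ∀ t, HasDerivAt V
      (2 * inner ℝ (r t) (-(k₂ • r t) + w t) + Γ * (2 * inner ℝ (xt t) (r t - k₁ • xt t))) t := by
    intro t
    rw [funext hV]
    exact (hrd t).norm_sq.add ((hxd t).norm_sq.const_mul Γ)
  have hVle : ∀ t ≥ (0 : ℝ), V t ≤ c := by
    intro t ht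
    refine le_of_deriv_nonpos_above_level hVd (fun s hs => ?_) h0 ht
    rw [hc, hV] at hs
    have hrate := lyapunov_rate_nonpos hk₁ hk₂ hΓ hΓk (norm_nonneg (r s)) hs
    have hrw : inner ℝ (r s) (w s) ≤ ‖r s‖ * D :=
      (real_inner_le_norm _ _).trans (mul_le_mul_of_nonneg_left (hw s) (norm_nonneg _))
    have hxr : Γ * inner ℝ (xt s) (r s) ≤ Γ * (‖r s‖ * ‖xt s‖) := by
      rw [mul_comm ‖r s‖]
      exact mul_le_mul_of_nonneg_left (real_inner_le_norm _ _) hΓ.le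
    simp only [inner_add_right, inner_sub_right, inner_neg_right, real_inner_smul_right,
      real_inner_self_eq_norm_sq]
    linarith
  intro t ht
  have h := hVle t ht
  refine ⟨h, Real.le_sqrt_of_sq_le ?_, Real.le_sqrt_of_sq_le ?_⟩
  · rw [le_div_iff₀ hΓ]
    rw [hV] at h
    nlinarith [sq_nonneg ‖r t‖]
  · rw [hV] at h
    have : 0 ≤ Γ * ‖xt t‖ ^ 2 := by positivity
    linarith
end
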